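/- Fix N ≥ 3, 1 < p ≤ N, and 1 < s < 2 satisfying s + 2/N < 1 + N/p. Then there exist a sequence u_k ∈ C_c^∞(ℝ^N) and a test function φ ∈ C_c^∞(ℝ^N) such that ‖u_k‖_{s,p} → 0 as k → ∞ and ∫_{ℝ^N} det(D²u_k) φ dx → ∞ as k → ∞. -/

import Mathlib

open MeasureTheory Real Filter

noncomputable section

abbrev Eu (N : ℕ) : Type := EuclideanSpace ℝ (Fin N)

def ebasis {N : ℕ} (i : Fin N) : Eu N := EuclideanSpace.single i 1

/-- Partial derivative `∂ᵢ u (x)`. -/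
def pd {N : ℕ} (u : Eu N → ℝ) (i : Fin N) (x : Eu N) : ℝ :=
  fderiv ℝ u x (ebasis i)

/-- Second partial derivative `∂ᵢ∂ⱼ u (x)`. -/
def pd2 {N : ℕ} (u : Eu N → ℝ) (i j : Fin N) (x : Eu N) : ℝ :=
  fderiv ℝ (fun y => fderiv ℝ u y (ebasis j)) x (ebasis i)

/-- The determinant of the Hessian matrix `det (D²u)(x)`. -/
def hessDet {N : ℕ} (u : Eu N → ℝ) (x : Eu N) : ℝ :=
  (Matrix.of fun i j => pd2 u i j x).det

/-- The Besov norm `‖u‖_{s,p}`. -/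
def besov (N : ℕ) (s p : ℝ) (u : Eu N → ℝ) : ℝ :=
  (∫ x : Eu N, |u x| ^ p) ^ (1/p)
  + (∫ x : Eu N, ‖fderiv ℝ u x‖ ^ p) ^ (1/p)
  + (∫ x : Eu N, ∫ y : Eu N,
      ‖fderiv ℝ u x - fderiv ℝ u y‖ ^ p / ‖x - y‖ ^ ((N : ℝ) + (s-1)*p)) ^ (1/p)

open Polynomial in
theorem profile_exists : ∃ g g1 g2 : ℝ → ℝ, ContDiff ℝ (⊤ : ℕ∞) g ∧ (∀ t, HasDerivAt g (g1 t) t) ∧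
    (∀ t, HasDerivAt g1 (g2 t) t) ∧ Continuous g2 ∧ (∀ t, 1 ≤ t → g t = 0 ∧ g1 t = 0 ∧ g2 t = 0) ∧
    (∀ t, t < 1 → g1 t < 0) := by
  have hd : ∀ t : ℝ, HasDerivAt (fun t : ℝ => 1 - t) (-1) t := fun t => by
    simpa using (hasDerivAt_id t).const_sub 1
  have key : ∀ (q : ℝ[X]) (t : ℝ), HasDerivAt
      (fun t => q.eval (1 - t)⁻¹ * expNegInvGlue (1 - t))
      ((-(X ^ 2 * (q - derivative q))).eval (1 - t)⁻¹ * expNegInvGlue (1 - t)) t := by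
    intro q t
    have h := (expNegInvGlue.hasDerivAt_polynomial_eval_inv_mul q (1 - t)).comp t (hd t)
    refine h.congr_deriv ?_
    simp
  have e0 : (fun t => expNegInvGlue (1 - t)) =
      (fun t => (1 : ℝ[X]).eval (1 - t)⁻¹ * expNegInvGlue (1 - t)) := by
    funext t; simp
  refine ⟨fun t => expNegInvGlue (1 - t), _, _, ?_, ?_, fun t => key (-(X ^ 2 * (1 - derivative 1))) t, ?_, ?_, ?_⟩
  · exact expNegInvGlue.contDiff.comp (contDiff_const.sub contDiff_id)
  · intro t; rw [e0]; exact key 1 t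
  · exact (expNegInvGlue.continuous_polynomial_eval_inv_mul _).comp
      (continuous_const.sub continuous_id)
  · intro t ht
    have : expNegInvGlue (1 - t) = 0 := expNegInvGlue.zero_of_nonpos (by linarith)
    simp [this]
  · intro t ht
    have h1 : 0 < expNegInvGlue (1 - t) := expNegInvGlue.pos_of_pos (by linarith)
    have h2 : 0 < (1 - t)⁻¹ := inv_pos.2 (by linarith)
    have : 0 < ((1 - t)⁻¹) ^ 2 * expNegInvGlue (1 - t) := by positivity
    simp only [derivative_one, sub_zero, mul_one, eval_neg, eval_pow, eval_X]
    linarith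

theorem det_rank_one {N : ℕ} (hN : 3 ≤ N) (a b : ℝ) (x : Eu N) :
    (Matrix.of fun i j : Fin N => a * (if i = j then 1 else 0) + b * (x i * x j)).det
      = a ^ (N - 1) * (a + b * ‖x‖ ^ 2) := by
  have : Nontrivial (Fin N) := Fin.nontrivial_iff_two_le.2 (by omega)
  have hx : ‖x‖ ^ 2 = ∑ i, x i * x i := by
    rw [EuclideanSpace.norm_sq_eq]; simp [sq]
  by_cases ha : a = 0
  · subst ha
    have : (Matrix.of fun i j : Fin N => (0:ℝ) * (if i = j then 1 else 0) + b * (x i * x j))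
        = Matrix.vecMulVec (fun i => b * x i) (fun j => x j) := by
      ext i j; simp [Matrix.vecMulVec_apply, mul_assoc]
    rw [this, Matrix.det_vecMulVec, zero_pow (by omega), zero_mul]
  · have : (Matrix.of fun i j : Fin N => a * (if i = j then 1 else 0) + b * (x i * x j))
        = a • (1 + Matrix.replicateCol Unit (fun i => b / a * x i) *
            Matrix.replicateRow Unit (fun j => x j)) := by
      ext i j
      simp only [Matrix.of_apply, Matrix.smul_apply, Matrix.add_apply, Matrix.mul_apply,
        Matrix.one_apply, Matrix.replicateCol_apply, Matrix.replicateRow_apply,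
        Finset.univ_unique, Finset.sum_singleton, smul_eq_mul, mul_add]
      congr 1
      field_simp
    rw [this, Matrix.det_smul, Matrix.det_one_add_replicateCol_mul_replicateRow, hx]
    obtain ⟨M, rfl⟩ : ∃ M, N = M + 1 := ⟨N - 1, by omega⟩
    simp only [Fintype.card_fin, dotProduct, Nat.add_sub_cancel, pow_succ, mul_assoc]
    congr 1
    rw [mul_add, Finset.mul_sum, Finset.mul_sum, mul_one]
    congr 1
    refine Finset.sum_congr rfl fun i _ => ?_
    field_simp

theorem fderiv_radial {N : ℕ} {g g1 : ℝ → ℝ} (hg : ∀ t, HasDerivAt g (g1 t) t) (x : Eu N)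
    (j : Fin N) :
    fderiv ℝ (fun x : Eu N => g (‖x‖ ^ 2)) x (ebasis j) = 2 * g1 (‖x‖ ^ 2) * x j := by
  have h := (hg (‖x‖ ^ 2)).comp_hasFDerivAt x (hasStrictFDerivAt_norm_sq x).hasFDerivAt
  have h2 : fderiv ℝ (fun x : Eu N => g (‖x‖ ^ 2)) x = _ := h.fderiv
  rw [h2]
  simp [ebasis, EuclideanSpace.inner_single_right]
  ring

theorem hessDet_radial {N : ℕ} (hN : 3 ≤ N) {g g1 g2 : ℝ → ℝ} (hg : ∀ t, HasDerivAt g (g1 t) t)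
    (hg1 : ∀ t, HasDerivAt g1 (g2 t) t) (x : Eu N) :
    hessDet (fun x : Eu N => g (‖x‖ ^ 2)) x
      = (2 * g1 (‖x‖ ^ 2)) ^ (N - 1) * (2 * g1 (‖x‖ ^ 2) + 4 * g2 (‖x‖ ^ 2) * ‖x‖ ^ 2) := by
  rw [← det_rank_one hN]
  unfold hessDet
  congr 1
  ext i j
  simp only [Matrix.of_apply, pd2]
  have e : (fun y : Eu N => fderiv ℝ (fun x : Eu N => g (‖x‖ ^ 2)) y (ebasis j))
      = fun y => (2 * g1 (‖y‖ ^ 2)) * y j := by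
    funext y; exact fderiv_radial hg y j
  rw [e]
  have h := ((hg1 (‖x‖ ^ 2)).comp_hasFDerivAt x (hasStrictFDerivAt_norm_sq x).hasFDerivAt).const_mul 2
  have h3 : HasFDerivAt (fun y : Eu N => y j) (EuclideanSpace.proj j : Eu N →L[ℝ] ℝ) x :=
    (EuclideanSpace.proj j : Eu N →L[ℝ] ℝ).hasFDerivAt
  have h4 := h.mul h3
  have h5 : fderiv ℝ (fun y : Eu N => (2 * g1 (‖y‖ ^ 2)) * y j) x = _ := h4.fderiv
  rw [h5]
  simp [ebasis, EuclideanSpace.inner_single_right, Pi.single_apply, eq_comm]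
  ring

theorem moment_ne_zero {N : ℕ} (hN : 3 ≤ N) {g g1 g2 : ℝ → ℝ} (hg : ∀ t, HasDerivAt g (g1 t) t)
    (hg1 : ∀ t, HasDerivAt g1 (g2 t) t) (hc : Continuous g2)
    (hz : ∀ t, 1 ≤ t → g t = 0 ∧ g1 t = 0 ∧ g2 t = 0) (hneg : ∀ t, t < 1 → g1 t < 0) :
    (∫ x : Eu N, hessDet (fun x : Eu N => g (‖x‖ ^ 2)) x * ‖x‖ ^ 2) ≠ 0 := by
  have hc1 : Continuous g1 := continuous_iff_continuousAt.2 fun t => (hg1 t).continuousAt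
  obtain ⟨M, rfl⟩ : ∃ M, N = M + 1 := ⟨N - 1, by omega⟩
  simp_rw [hessDet_radial hN hg hg1]
  have h := integral_fun_norm_addHaar (volume : Measure (Eu (M + 1))) (fun r : ℝ =>
    ((2 * g1 (r ^ 2)) ^ (M + 1 - 1) * (2 * g1 (r ^ 2) + 4 * g2 (r ^ 2) * r ^ 2)) * r ^ 2)
  rw [h]
  have : Nontrivial (Fin (M + 1)) := Fin.nontrivial_iff_two_le.2 (by omega)
  have hdim : Module.finrank ℝ (Eu (M + 1)) = M + 1 := by simp
  rw [hdim]
  refine smul_ne_zero (by omega) (smul_ne_zero ?_ ?_)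
  · exact (ENNReal.toReal_pos (Metric.measure_ball_pos _ _ one_pos).ne'
      measure_ball_lt_top.ne).ne'
  rw [setIntegral_eq_of_subset_of_forall_sdiff_eq_zero (s := Set.Ioc 0 1) measurableSet_Ioi
    Set.Ioc_subset_Ioi_self]
  swap
  · rintro r ⟨hr0, hr1⟩
    have hr0 : 0 < r := hr0
    have : 1 < r := by
      by_contra hcon
      exact hr1 ⟨hr0, not_lt.1 hcon⟩
    have h1 : 1 ≤ r ^ 2 := by nlinarith
    simp [(hz _ h1).2.1, (hz _ h1).2.2]
  rw [← intervalIntegral.integral_of_le zero_le_one]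
  -- integrate by parts
  have hsq : ∀ r : ℝ, HasDerivAt (fun r : ℝ => r ^ 2) (2 * r) r := fun r => by
    simpa using hasDerivAt_pow 2 r
  have hw : ∀ r : ℝ, HasDerivAt (fun r => (2 * r * g1 (r ^ 2)) ^ (M + 1))
      ((M + 1 : ℕ) * (2 * r * g1 (r ^ 2)) ^ M * (2 * g1 (r ^ 2) + 4 * g2 (r ^ 2) * r ^ 2)) r := by
    intro r
    have h1 : HasDerivAt (fun r => g1 (r ^ 2)) (g2 (r ^ 2) * (2 * r)) r :=
      (hg1 (r ^ 2)).comp r (hsq r)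
    have h2 := ((((hasDerivAt_id r).const_mul 2).mul h1).pow (M + 1))
    refine h2.congr_deriv ?_
    simp
    left
    ring
  have ibp := intervalIntegral.integral_mul_deriv_eq_deriv_mul (a := 0) (b := 1)
    (fun r _ => hsq r) (fun r _ => hw r)
    ((by fun_prop : Continuous _).intervalIntegrable _ _)
    ((by fun_prop : Continuous _).intervalIntegrable _ _)
  have hpos : 0 < ∫ r in (0:ℝ)..1, (-1) ^ (M + 1) * (2 * r * (2 * r * g1 (r ^ 2)) ^ (M + 1)) := by
    refine intervalIntegral.intervalIntegral_pos_of_pos_on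
      ((by fun_prop : Continuous _).intervalIntegrable _ _) ?_ zero_lt_one
    rintro r ⟨hr0, hr1⟩
    have h1 : g1 (r ^ 2) < 0 := hneg _ (by nlinarith)
    have h2 : 0 < -1 * (2 * r * g1 (r ^ 2)) := by nlinarith
    have : (-1 : ℝ) ^ (M + 1) * (2 * r * (2 * r * g1 (r ^ 2)) ^ (M + 1))
      = 2 * r * (-1 * (2 * r * g1 (r ^ 2))) ^ (M + 1) := by
      rw [mul_pow (-1 : ℝ)]; ring
    rw [this]
    positivity
  intro h0
  have e : (fun r : ℝ => r ^ 2 * ((M + 1 : ℕ) * (2 * r * g1 (r ^ 2)) ^ M *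
      (2 * g1 (r ^ 2) + 4 * g2 (r ^ 2) * r ^ 2))) = fun r => ((M + 1 : ℕ) : ℝ) *
      (r ^ (M + 1 - 1) • (((2 * g1 (r ^ 2)) ^ (M + 1 - 1) *
        (2 * g1 (r ^ 2) + 4 * g2 (r ^ 2) * r ^ 2)) * r ^ 2)) := by
    funext r
    simp only [Nat.add_sub_cancel, smul_eq_mul]
    ring
  rw [e, intervalIntegral.integral_const_mul, h0] at ibp
  have hz1 : g1 1 = 0 := (hz 1 le_rfl).2.1
  simp [hz1] at ibp
  rw [intervalIntegral.integral_const_mul] at hpos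
  simp_all

theorem fderiv_scale {N : ℕ} (w : Eu N → ℝ) (hw : Differentiable ℝ w) (c R : ℝ) (x : Eu N) :
    fderiv ℝ (fun x => c * w (R • x)) x = (c * R) • fderiv ℝ w (R • x) := by
  have hd : DifferentiableAt ℝ (fun x => w (R • x)) x :=
    (hw (R • x)).comp x ((differentiableAt_id).const_smul R)
  rw [fderiv_const_mul hd, fderiv_comp_smul, smul_smul]

theorem hessDet_scale {N : ℕ} (w : Eu N → ℝ) (hw : ContDiff ℝ (⊤ : ℕ∞) w) (c R : ℝ) (x : Eu N) :
    hessDet (fun x => c * w (R • x)) x = (c * R ^ 2) ^ N * hessDet w (R • x) := by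
  have hdw : Differentiable ℝ w := hw.differentiable (by simp)
  have : (Matrix.of fun i j => pd2 (fun x => c * w (R • x)) i j x)
      = (c * R ^ 2) • (Matrix.of fun i j => pd2 w i j (R • x)) := by
    ext i j
    simp only [Matrix.of_apply, Matrix.smul_apply, pd2, smul_eq_mul]
    have e : (fun y => fderiv ℝ (fun x => c * w (R • x)) y (ebasis j))
      = fun y => (c * R) * (fun z => fderiv ℝ w z (ebasis j)) (R • y) := by
      funext y; rw [fderiv_scale w hdw]; simp
    rw [e, fderiv_scale (fun z => fderiv ℝ w z (ebasis j))]
    · simp only [ContinuousLinearMap.smul_apply, smul_eq_mul]; ring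
    · have h1 : ContDiff ℝ 1 (fderiv ℝ w) := hw.fderiv_right (by norm_cast)
      exact (h1.clm_apply contDiff_const).differentiable (by simp)
  unfold hessDet
  rw [this, Matrix.det_smul, Fintype.card_fin]

theorem scale_int {N : ℕ} (f : Eu N → ℝ) {R : ℝ} (hR : 0 < R) :
    ∫ x : Eu N, f (R • x) = R ^ (-(N : ℝ)) * ∫ x : Eu N, f x := by
  rw [Measure.integral_comp_smul_of_nonneg volume f R (hR := hR.le), rpow_neg hR.le, rpow_natCast]
  simp

theorem root_scale {p R a I : ℝ} (hp : 1 < p) (hR : 0 < R) (hI : 0 ≤ I) :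
    (R ^ a * I) ^ (1 / p) = R ^ (a / p) * I ^ (1 / p) := by
  rw [mul_rpow (rpow_nonneg hR.le _) hI, ← rpow_mul hR.le]
  congr 2; ring

theorem besov_scale {N : ℕ} (w : Eu N → ℝ) (hdw : Differentiable ℝ w) {p s α : ℝ} (hp : 1 < p) :
    ∃ A B C : ℝ, ∀ R : ℝ, 0 < R →
    besov N s p (fun x => R ^ α * w (R • x))
     = R ^ (α - N / p) * A + R ^ (α + 1 - N / p) * B + R ^ (α + s - N / p) * C := by
  refine ⟨(∫ x : Eu N, |w x| ^ p) ^ (1/p), (∫ x : Eu N, ‖fderiv ℝ w x‖ ^ p) ^ (1/p),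
    (∫ x : Eu N, ∫ y : Eu N,
      ‖fderiv ℝ w x - fderiv ℝ w y‖ ^ p / ‖x - y‖ ^ ((N : ℝ) + (s-1)*p)) ^ (1/p),
    fun R hR => ?_⟩
  have hp0 : p ≠ 0 := by linarith
  unfold besov
  simp_rw [fderiv_scale w hdw]
  have h1 : ∫ x : Eu N, |R ^ α * w (R • x)| ^ p
      = R ^ (α * p - N) * ∫ x : Eu N, |w x| ^ p := by
    rw [sub_eq_add_neg, rpow_add hR, mul_assoc, ← scale_int (fun x => |w x| ^ p) hR,
      ← integral_const_mul]
    congr 1; funext x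
    rw [abs_mul, abs_of_pos (rpow_pos_of_pos hR α), mul_rpow (by positivity) (abs_nonneg _),
      ← rpow_mul hR.le]
  have hn : ∀ z : Eu N →L[ℝ] ℝ, ‖(R ^ α * R) • z‖ ^ p = R ^ ((α + 1) * p) * ‖z‖ ^ p := by
    intro z
    have : R ^ α * R = R ^ (α + 1) := by rw [rpow_add hR, rpow_one]
    rw [this, norm_smul, norm_of_nonneg (by positivity), mul_rpow (by positivity) (norm_nonneg _),
      ← rpow_mul hR.le]
  have h2 : ∫ x : Eu N, ‖(R ^ α * R) • fderiv ℝ w (R • x)‖ ^ p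
      = R ^ ((α + 1) * p - N) * ∫ x : Eu N, ‖fderiv ℝ w x‖ ^ p := by
    rw [sub_eq_add_neg, rpow_add hR, mul_assoc, ← scale_int (fun x => ‖fderiv ℝ w x‖ ^ p) hR,
      ← integral_const_mul]
    congr 1; funext x
    rw [hn]
  have h3 : ∫ x : Eu N, ∫ y : Eu N, ‖(R ^ α * R) • fderiv ℝ w (R • x)
        - (R ^ α * R) • fderiv ℝ w (R • y)‖ ^ p / ‖x - y‖ ^ ((N : ℝ) + (s-1)*p)
      = R ^ ((α + 1) * p + (N + (s - 1) * p) + -N + -N) * ∫ x : Eu N, ∫ y : Eu N,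
        ‖fderiv ℝ w x - fderiv ℝ w y‖ ^ p / ‖x - y‖ ^ ((N : ℝ) + (s-1)*p) := by
    rw [rpow_add hR, mul_assoc, ← scale_int (fun x => ∫ y : Eu N,
        ‖fderiv ℝ w x - fderiv ℝ w y‖ ^ p / ‖x - y‖ ^ ((N : ℝ) + (s-1)*p)) hR,
      ← integral_const_mul]
    congr 1; funext x
    rw [rpow_add hR, mul_assoc, ← scale_int (fun y =>
        ‖fderiv ℝ w (R • x) - fderiv ℝ w y‖ ^ p / ‖R • x - y‖ ^ ((N : ℝ) + (s-1)*p)) hR,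
      ← integral_const_mul]
    congr 1; funext y
    rw [← smul_sub, hn, ← smul_sub, norm_smul, norm_of_nonneg hR.le,
      mul_rpow hR.le (norm_nonneg _), rpow_add hR]
    have : R ^ ((N : ℝ) + (s-1)*p) ≠ 0 := (rpow_pos_of_pos hR _).ne'
    field_simp
  rw [h1, h2, h3, root_scale hp hR, root_scale hp hR, root_scale hp hR]
  · congr 3
    · congr 1; field_simp
    · congr 2; field_simp
    · field_simp; ring
  all_goals positivity

/-- Optimality in the case `1 < p ≤ N`, `s + 2/N < 1 + N/p`: failure of continuity
by a scaling argument. -/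
theorem stmt8 (N : ℕ) (hN : 3 ≤ N) (p s : ℝ) (hp1 : 1 < p) (hpN : p ≤ (N : ℝ))
    (hs1 : 1 < s) (hs2 : s < 2) (hcond : s + 2/(N:ℝ) < 1 + (N:ℝ)/p) :
    ∃ (u : ℕ → Eu N → ℝ) (φ : Eu N → ℝ),
      (∀ k, ContDiff ℝ (⊤ : ℕ∞) (u k)) ∧ (∀ k, HasCompactSupport (u k)) ∧
      ContDiff ℝ (⊤ : ℕ∞) φ ∧ HasCompactSupport φ ∧
      Tendsto (fun k => besov N s p (u k)) atTop (nhds 0) ∧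
      Tendsto (fun k => ∫ x : Eu N, hessDet (u k) x * φ x) atTop atTop := by
  obtain ⟨g, g1, g2, hgs, hg, hg1, hc, hz, hneg⟩ := profile_exists
  have hI := moment_ne_zero hN hg hg1 hc hz hneg
  have hH := fun x : Eu N => hessDet_radial hN hg hg1 x
  set v : Eu N → ℝ := fun x => g (‖x‖ ^ 2) with hv
  set I : ℝ := ∫ x : Eu N, hessDet v x * ‖x‖ ^ 2 with hIdef
  have hvs : ContDiff ℝ (⊤ : ℕ∞) v := hgs.comp (contDiff_norm_sq ℝ)
  have hvc : HasCompactSupport v := by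
    refine HasCompactSupport.intro (isCompact_closedBall (0 : Eu N) 1) fun x hx => ?_
    have : 1 < ‖x‖ := by simpa using hx
    exact (hz _ (by nlinarith)).1
  obtain ⟨α, hα1, hα2⟩ : ∃ α : ℝ, 2 / (N:ℝ) - 1 < α ∧ α < N / p - s :=
    exists_between (by linarith)
  let χ : ContDiffBump (0 : Eu N) := ⟨1, 2, one_pos, one_lt_two⟩
  have hRpos : ∀ k : ℕ, (0:ℝ) < (k:ℝ) + 1 := fun k => by positivity
  have hRt : Tendsto (fun k : ℕ => (k:ℝ) + 1) atTop atTop :=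
    tendsto_atTop_add_const_right _ _ tendsto_natCast_atTop_atTop
  refine ⟨fun k x => ((k:ℝ) + 1) ^ α * v (((k:ℝ) + 1) • x), fun x => I * (χ x * ‖x‖ ^ 2),
    fun k => ?_, fun k => ?_, ?_, ?_, ?_, ?_⟩
  · exact contDiff_const.mul (hvs.comp (contDiff_id.const_smul _))
  · exact (hvc.comp_smul (hRpos k).ne').mul_left
  · exact contDiff_const.mul (χ.contDiff.mul (contDiff_norm_sq ℝ))
  · exact (χ.hasCompactSupport.mul_right).mul_left
  · obtain ⟨A, B, C, h⟩ := besov_scale (s := s) (α := α) v (hvs.differentiable (by simp)) hp1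
    simp_rw [fun k : ℕ => h _ (hRpos k)]
    have ht : ∀ b : ℝ, ∀ A : ℝ, b < 0 → Tendsto (fun k : ℕ => ((k:ℝ) + 1) ^ b * A) atTop (nhds 0) := by
      intro b A hb
      have := ((tendsto_rpow_neg_atTop (y := -b) (by linarith)).comp hRt).mul_const A
      simpa [Function.comp_def] using this
    have := ((ht (α - N / p) A (by linarith)).add (ht (α + 1 - N / p) B (by linarith))).add
      (ht (α + s - N / p) C (by linarith))
    simpa using this
  · have hN0 : (0:ℝ) < N := by
      have : 0 < N := by omega
      exact_mod_cast this
    have key : ∀ k : ℕ, ∫ x : Eu N, hessDet (fun x => ((k:ℝ) + 1) ^ α * v (((k:ℝ) + 1) • x)) x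
        * (I * (χ x * ‖x‖ ^ 2)) = ((k:ℝ) + 1) ^ (N * α + N - 2) * (I * I) := by
      intro k
      have hR := hRpos k
      have hR1 : (1:ℝ) ≤ (k:ℝ) + 1 := by simp
      generalize (k:ℝ) + 1 = R at hR hR1
      have hpow : R ^ (N * α + N - 2 : ℝ) = ((R ^ α * R ^ 2) ^ N * R ^ (-2 : ℝ)) * R ^ (-(N:ℝ)) := by
        rw [← rpow_natCast (R ^ α * R ^ 2) N, ← rpow_natCast R 2, ← rpow_add hR, ← rpow_mul hR.le,
          ← rpow_add hR, ← rpow_add hR]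
        congr 1; push_cast; ring
      rw [hpow]
      have : I * I = ∫ x : Eu N, I * (hessDet v x * ‖x‖ ^ 2) := by
        rw [integral_const_mul]
      rw [this, mul_assoc, ← scale_int (fun x => I * (hessDet v x * ‖x‖ ^ 2)) hR,
        ← integral_const_mul]
      congr 1; funext x
      rw [hessDet_scale v hvs]
      have hx2 : ‖R • x‖ ^ 2 = R ^ 2 * ‖x‖ ^ 2 := by
        rw [norm_smul, norm_of_nonneg hR.le, mul_pow]
      have hR2 : R ^ (-2 : ℝ) * R ^ 2 = 1 := by
        rw [← rpow_natCast R 2, ← rpow_add hR]; simp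
      by_cases hx : ‖x‖ ≤ 1
      · have : χ x = 1 := χ.one_of_mem_closedBall (by simpa [χ] using hx)
        rw [this, hx2]
        linear_combination (-(R ^ α * R ^ 2) ^ N * I * hessDet v (R • x) * ‖x‖ ^ 2) * hR2
      · have h1 : 1 ≤ ‖R • x‖ ^ 2 := by
          rw [norm_smul, norm_of_nonneg hR.le]
          exact one_le_pow₀ (one_le_mul_of_one_le_of_one_le hR1 (not_le.1 hx).le)
        have : hessDet v (R • x) = 0 := by
          rw [hH, (hz _ h1).2.1, (hz _ h1).2.2]; simp
        simp [this]
    simp_rw [key]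
    refine Tendsto.atTop_mul_const (mul_self_pos.2 hI) ?_
    refine (tendsto_rpow_atTop ?_).comp hRt
    have : 2 / (N:ℝ) * N = 2 := by field_simp
    nlinarith
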